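/- For every partition λ of n into at most p parts and every D ∈ P(n,p), the trace inner product ⟨A_D, e_λ e_λ^T⟩ = e_λ^T A_D e_λ equals the coefficient of the monomial x^D in the polynomial P_λ. Equivalently, f_{e_λ e_λ^T} = P_λ. -/

import Mathlib

open scoped Classical
open Matrix

noncomputable section

/-- `D(a,b) ∈ ℕ^{p×p}`: `D(a,b)_{i,j}` counts positions `k` with `a_k = i` and `b_k = j`. -/
def Dmat {n p : ℕ} (a b : Fin n → Fin p) : Matrix (Fin p) (Fin p) ℕ :=
  Matrix.of fun i j => (Finset.univ.filter fun k => a k = i ∧ b k = j).card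

/-- The 0/1 matrix `A_D` with `(A_D)_{a,b} = 1` iff `D(a,b) = D`. -/
def AD (n p : ℕ) (D : Matrix (Fin p) (Fin p) ℕ) :
    Matrix (Fin n → Fin p) (Fin n → Fin p) ℂ :=
  Matrix.of fun a b => if Dmat a b = D then 1 else 0

/-- Row (0-indexed) of the `k`-th box (0-indexed, row-major numbering) of the Ferrers
diagram of `lam`: the number of indices `i` with `λ_0 + ⋯ + λ_i ≤ k`. -/
def rowOf (p : ℕ) (lam : Fin p → ℕ) (k : ℕ) : ℕ :=
  (Finset.univ.filter fun i : Fin p => (∑ j ∈ Finset.univ.filter (· ≤ i), lam j) ≤ k).card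

/-- Column (0-indexed) of the `k`-th box of the Ferrers diagram of `lam`. -/
def colOf (p : ℕ) (lam : Fin p → ℕ) (k : ℕ) : ℕ :=
  k - ∑ j ∈ Finset.univ.filter (fun j : Fin p => (j : ℕ) < rowOf p lam k), lam j

/-- The column group `C_λ`: permutations of the boxes mapping every box to a box
in the same column. -/
def colGroup (n p : ℕ) (lam : Fin p → ℕ) : Finset (Equiv.Perm (Fin n)) :=
  Finset.univ.filter fun σ => ∀ k : Fin n, colOf p lam (σ k : ℕ) = colOf p lam (k : ℕ)

/-- The row group `R_λ`: permutations of the boxes mapping every box to a box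
in the same row. -/
def rowGroup (n p : ℕ) (lam : Fin p → ℕ) : Finset (Equiv.Perm (Fin n)) :=
  Finset.univ.filter fun σ => ∀ k : Fin n, rowOf p lam (σ k : ℕ) = rowOf p lam (k : ℕ)

/-- The vector `e_t = Σ_{σ ∈ C_λ} sgn(σ) Σ_{t' ∼ t} χ^{σ t'} ∈ ℂ^{[p]^n}`, where `t' ∼ t`
means `t' = π t` for some `π ∈ R_λ`, and `(σ t)(k) = t(σ⁻¹ k)`. -/
noncomputable def eT (n p : ℕ) (lam : Fin p → ℕ) (t : Fin n → Fin p) :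
    (Fin n → Fin p) → ℂ :=
  ∑ σ ∈ colGroup n p lam, ((Equiv.Perm.sign σ : ℤ) : ℂ) •
    ∑ t' ∈ Finset.univ.filter (fun t' : Fin n → Fin p =>
        ∃ π ∈ rowGroup n p lam, t' = fun k => t (π⁻¹ k)),
      (Pi.single (fun k => t' (σ⁻¹ k)) (1 : ℂ) : (Fin n → Fin p) → ℂ)

/-- The tableau `t_λ` whose entries in row `i` all equal `i`. -/
def tLam (n p : ℕ) (hp : 0 < p) (lam : Fin p → ℕ) : Fin n → Fin p :=
  fun k => ⟨rowOf p lam (k : ℕ) % p, Nat.mod_lt _ hp⟩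

/-- The vector `e_λ := e_{t_λ}`. -/
noncomputable def eLam (n p : ℕ) (hp : 0 < p) (lam : Fin p → ℕ) : (Fin n → Fin p) → ℂ :=
  eT n p lam (tLam n p hp lam)

/-- The polynomial `Q_k = k! · det((x_{i,j})_{1 ≤ i,j ≤ k})` in the variables
`x_{i,j}`, `i,j ∈ [p]` (for `k ≤ p`; `Q_0 = 1`). -/
noncomputable def Qpoly (p k : ℕ) : MvPolynomial (Fin p × Fin p) ℂ :=
  (k.factorial : MvPolynomial (Fin p × Fin p) ℂ) *
    Matrix.det (Matrix.of fun i j : Fin k =>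
      if h : (i : ℕ) < p ∧ (j : ℕ) < p then MvPolynomial.X (⟨i, h.1⟩, ⟨j, h.2⟩) else 0)

/-- The conjugate (dual) partition: `λ*_j = |{i : λ_i ≥ j}|`. -/
def conjPart (p : ℕ) (lam : Fin p → ℕ) (j : ℕ) : ℕ :=
  (Finset.univ.filter fun i : Fin p => j ≤ lam i).card

/-- The polynomial `P_λ = ∏_{j=1}^n Q_{λ*_j}`. -/
noncomputable def Ppoly (n p : ℕ) (lam : Fin p → ℕ) : MvPolynomial (Fin p × Fin p) ℂ :=
  ∏ j ∈ Finset.range n, Qpoly p (conjPart p lam (j + 1))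

/-- The exponent (as a finitely supported function on `Fin p × Fin p`) of the monomial
`x^D` attached to `D ∈ ℕ^{p×p}`. -/
noncomputable def expOf (p : ℕ) (D : Matrix (Fin p) (Fin p) ℕ) : (Fin p × Fin p) →₀ ℕ :=
  Finsupp.equivFunOnFinite.symm fun ij : Fin p × Fin p => D ij.1 ij.2

/-- The polynomial `f_A = Σ_{D ∈ P(n,p)} x^D ⟨A_D, A⟩`, where `⟨M,N⟩ = trace(N^*M)`
(matrices `D ∈ P(n,p)` are encoded with entries in `Fin (n+1)`). -/
noncomputable def fPoly (n p : ℕ) (A : Matrix (Fin n → Fin p) (Fin n → Fin p) ℂ) :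
    MvPolynomial (Fin p × Fin p) ℂ :=
  ∑ D ∈ (Finset.univ : Finset (Fin p → Fin p → Fin (n + 1))).filter
      (fun D => ∑ i, ∑ j, (D i j : ℕ) = n),
    MvPolynomial.monomial (expOf p (Matrix.of fun i j => (D i j : ℕ)))
      (Matrix.trace (Aᴴ * AD n p (Matrix.of fun i j => (D i j : ℕ))))

/-! ### Geometry of the Ferrers diagram -/

/-- The total length of the first `r` rows. -/
def rowStart (p : ℕ) (lam : Fin p → ℕ) (r : ℕ) : ℕ :=
  ∑ j ∈ Finset.univ.filter (fun j : Fin p => (j : ℕ) < r), lam j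

theorem rowStart_mono (p : ℕ) (lam : Fin p → ℕ) : Monotone (rowStart p lam) := by
  intro r s hrs
  refine Finset.sum_le_sum_of_subset fun j hj => ?_
  simp only [Finset.mem_filter, Finset.mem_univ, true_and] at hj ⊢
  omega

theorem rowStart_zero (p : ℕ) (lam : Fin p → ℕ) : rowStart p lam 0 = 0 := by
  simp [rowStart]

theorem rowStart_self (p : ℕ) (lam : Fin p → ℕ) : rowStart p lam p = ∑ i, lam i := by
  simp [rowStart]

theorem rowStart_succ {p : ℕ} (lam : Fin p → ℕ) (i : Fin p) :
    rowStart p lam (i + 1) = rowStart p lam i + lam i := by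
  have h : Finset.univ.filter (fun j : Fin p => (j : ℕ) < i + 1) =
      insert i (Finset.univ.filter (fun j : Fin p => (j : ℕ) < i)) := by
    ext j
    simp only [Finset.mem_filter, Finset.mem_univ, true_and, Finset.mem_insert, Fin.ext_iff]
    omega
  rw [rowStart, h, Finset.sum_insert (by simp), rowStart, add_comm]

theorem lt_rowOf_iff {p : ℕ} (lam : Fin p → ℕ) (k : ℕ) (i : Fin p) :
    (i : ℕ) < rowOf p lam k ↔ rowStart p lam (i + 1) ≤ k := by
  have h : ∀ i : Fin p,
      ∑ j ∈ Finset.univ.filter (· ≤ i), lam j = rowStart p lam (i + 1) := by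
    intro i
    refine Finset.sum_congr ?_ fun _ _ => rfl
    ext j
    simp only [Finset.mem_filter, Finset.mem_univ, true_and, Fin.le_def]
    omega
  simp only [rowOf, h]
  refine Fin.lt_card_filter_univ_iff_apply_of_imp
    (fun i : Fin p => rowStart p lam (i + 1) ≤ k) ?_
  exact fun j i hij hj =>
    (rowStart_mono p lam (Nat.succ_le_succ (Fin.le_def.mp hij))).trans hj

theorem rowOf_lt {p : ℕ} (lam : Fin p → ℕ) {k : ℕ} (hk : k < ∑ i, lam i) :
    rowOf p lam k < p := by
  by_contra h
  rcases Nat.eq_zero_or_pos p with rfl | hp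
  · simp at hk
  · have := (lt_rowOf_iff lam k ⟨p - 1, by omega⟩).mp (by simp only; omega)
    simp only [Nat.sub_add_cancel hp, rowStart_self] at this
    omega

theorem rowStart_rowOf_le {p : ℕ} (lam : Fin p → ℕ) {k : ℕ} (hk : k < ∑ i, lam i) :
    rowStart p lam (rowOf p lam k) ≤ k := by
  have hr := rowOf_lt lam hk
  rcases h : rowOf p lam k with _ | r
  · simp [rowStart_zero]
  · exact (lt_rowOf_iff lam k ⟨r, by omega⟩).mp (by simp only; omega)

theorem rowStart_rowOf_add_colOf {p : ℕ} (lam : Fin p → ℕ) {k : ℕ} (hk : k < ∑ i, lam i) :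
    rowStart p lam (rowOf p lam k) + colOf p lam k = k := by
  have : colOf p lam k = k - rowStart p lam (rowOf p lam k) := rfl
  have := rowStart_rowOf_le lam hk
  omega

theorem colOf_lt {p : ℕ} (lam : Fin p → ℕ) {k : ℕ} (hk : k < ∑ i, lam i) :
    colOf p lam k < lam ⟨rowOf p lam k, rowOf_lt lam hk⟩ := by
  have h := (lt_rowOf_iff lam k ⟨rowOf p lam k, rowOf_lt lam hk⟩).not.mp (lt_irrefl _)
  rw [rowStart_succ] at h
  have := rowStart_rowOf_add_colOf lam hk
  simp only at h
  omega

theorem rowOf_rowStart_add {p : ℕ} (lam : Fin p → ℕ) (i : Fin p) {c : ℕ} (hc : c < lam i) :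
    rowOf p lam (rowStart p lam i + c) = i := by
  refine le_antisymm (not_lt.mp fun h => ?_) (not_lt.mp fun h => ?_)
  · have := (lt_rowOf_iff lam _ i).mp h
    rw [rowStart_succ] at this
    omega
  · have h' := (lt_rowOf_iff lam (rowStart p lam i + c)
      ⟨rowOf p lam (rowStart p lam i + c), h.trans i.2⟩).not.mp (lt_irrefl _)
    have := rowStart_mono p lam (Nat.succ_le_of_lt h)
    simp only [Nat.succ_eq_add_one] at this h'
    omega

theorem colOf_rowStart_add {p : ℕ} (lam : Fin p → ℕ) (i : Fin p) {c : ℕ} (hc : c < lam i) :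
    colOf p lam (rowStart p lam i + c) = c := by
  have h : colOf p lam (rowStart p lam i + c) =
    (rowStart p lam i + c) - rowStart p lam (rowOf p lam (rowStart p lam i + c)) := rfl
  rw [h, rowOf_rowStart_add lam i hc]
  omega

theorem rowStart_add_lt {p : ℕ} (lam : Fin p → ℕ) (i : Fin p) {c : ℕ} (hc : c < lam i) :
    rowStart p lam i + c < ∑ j, lam j := by
  rw [← rowStart_self]
  have := rowStart_mono p lam (Nat.succ_le_of_lt i.2)
  rw [Nat.succ_eq_add_one, rowStart_succ] at this
  omega

theorem conjPart_le (p : ℕ) (lam : Fin p → ℕ) (j : ℕ) : conjPart p lam j ≤ p :=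
  (Finset.card_le_univ _).trans_eq (Fintype.card_fin p)

theorem lt_conjPart_iff {p : ℕ} {lam : Fin p → ℕ}
    (hdec : ∀ i j : Fin p, i ≤ j → lam j ≤ lam i) (c : ℕ) (i : Fin p) :
    (i : ℕ) < conjPart p lam (c + 1) ↔ c < lam i :=
  Fin.lt_card_filter_univ_iff_apply_of_imp (fun i : Fin p => c + 1 ≤ lam i)
    (fun j i hij hj => hj.trans (hdec i j hij))

/-- The column of a box, as an element of `Fin n`. -/
def boxCol {n p : ℕ} (lam : Fin p → ℕ) (k : Fin n) : Fin n :=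
  ⟨colOf p lam k, (Nat.sub_le _ _).trans_lt k.2⟩

/-- The boxes in column `c` are indexed by their rows. -/
def colEquiv {n p : ℕ} (lam : Fin p → ℕ) (hdec : ∀ i j : Fin p, i ≤ j → lam j ≤ lam i)
    (hsum : ∑ i, lam i = n) (c : Fin n) :
    {k : Fin n // boxCol lam k = c} ≃ Fin (conjPart p lam (c + 1)) where
  toFun k := ⟨rowOf p lam k.1, by
    have hk : (k.1 : ℕ) < ∑ i, lam i := hsum ▸ k.1.2
    have hc : colOf p lam k.1 = c := congrArg Fin.val k.2
    exact (lt_conjPart_iff hdec c ⟨_, rowOf_lt lam hk⟩).mpr (hc ▸ colOf_lt lam hk)⟩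
  invFun i :=
    have hi : (c : ℕ) < lam ⟨i, i.2.trans_le (conjPart_le p lam _)⟩ :=
      (lt_conjPart_iff hdec c ⟨i, i.2.trans_le (conjPart_le p lam _)⟩).mp i.2
    ⟨⟨rowStart p lam i + c, hsum ▸ rowStart_add_lt lam _ hi⟩,
      Fin.ext (colOf_rowStart_add lam _ hi)⟩
  left_inv k := by
    have hk : (k.1 : ℕ) < ∑ i, lam i := hsum ▸ k.1.2
    have hc : colOf p lam k.1 = c := congrArg Fin.val k.2
    refine Subtype.ext (Fin.ext ?_)
    simpa only [hc] using rowStart_rowOf_add_colOf lam hk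
  right_inv i := Fin.ext <| rowOf_rowStart_add lam ⟨i, i.2.trans_le (conjPart_le p lam _)⟩
    ((lt_conjPart_iff hdec c ⟨i, i.2.trans_le (conjPart_le p lam _)⟩).mp i.2)

theorem mem_colGroup_iff {n p : ℕ} (lam : Fin p → ℕ) (σ : Equiv.Perm (Fin n)) :
    σ ∈ colGroup n p lam ↔ ∀ k, boxCol lam (σ k) = boxCol lam k := by
  simp only [colGroup, Finset.mem_filter, Finset.mem_univ, true_and, boxCol, Fin.ext_iff]

theorem mul_mem_colGroup_iff {n p : ℕ} {lam : Fin p → ℕ} {σ : Equiv.Perm (Fin n)}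
    (hσ : σ ∈ colGroup n p lam) (ρ : Equiv.Perm (Fin n)) :
    σ * ρ ∈ colGroup n p lam ↔ ρ ∈ colGroup n p lam := by
  rw [mem_colGroup_iff] at hσ
  simp [mem_colGroup_iff, hσ]

theorem card_colGroup {n p : ℕ} (lam : Fin p → ℕ)
    (hdec : ∀ i j : Fin p, i ≤ j → lam j ≤ lam i) (hsum : ∑ i, lam i = n) :
    (colGroup n p lam).card = ∏ c : Fin n, (conjPart p lam (c + 1)).factorial := by
  have h := DomMulAct.stabilizer_card (boxCol lam : Fin n → Fin n)
  have h' : ∀ c : Fin n, Fintype.card {k : Fin n // boxCol lam k = c} =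
      conjPart p lam (c + 1) := fun c => by
    rw [Fintype.card_congr (colEquiv lam hdec hsum c), Fintype.card_fin]
  simp only [h'] at h
  rw [← h, Fintype.card_subtype]
  congr 1
  ext σ
  simp [mem_colGroup_iff, funext_iff]

/-! ### Block determinants -/

theorem sum_sign_mul_prod_eq_prod_det {m α R : Type*} [Fintype m] [DecidableEq m] [Fintype α]
    [LinearOrder α] [CommRing R] (b : m → α) (N : Matrix m m R) (s : Finset (Equiv.Perm m))
    (hs : ∀ ρ, ρ ∈ s ↔ ∀ k, b (ρ k) = b k) :
    ∑ ρ ∈ s, ((Equiv.Perm.sign ρ : ℤ) : R) * ∏ k, N (ρ k) k =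
      ∏ c, (N.toSquareBlock b c).det := by
  set M : Matrix m m R := Matrix.of fun k l => if b k = b l then N k l else 0 with hM
  have hblock : ∀ c, N.toSquareBlock b c = M.toSquareBlock b c := by
    intro c
    ext k l
    simp [hM, Matrix.toSquareBlock_def, k.2, l.2]
  have htri : M.BlockTriangular b := fun k l hkl => by simp [hM, hkl.ne']
  simp_rw [hblock]
  rw [← htri.det_fintype, Matrix.det_apply']
  refine Finset.sum_subset_zero_on_sdiff (Finset.subset_univ s) (fun ρ hρ => ?_) fun ρ hρ => ?_
  · rw [Finset.mem_sdiff, hs] at hρ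
    obtain ⟨k, hk⟩ := not_forall.mp hρ.2
    rw [Finset.prod_eq_zero (Finset.mem_univ k) (by simp [hM, hk]), mul_zero]
  · simp [hM, (hs ρ).mp hρ]

/-! ### Generating polynomials -/

theorem expOf_Dmat {n p : ℕ} (a b : Fin n → Fin p) :
    expOf p (Dmat a b) = ∑ k, Finsupp.single (a k, b k) 1 := by
  ext ⟨i, j⟩
  simp [expOf, Dmat, Finsupp.finsetSum_apply, Finsupp.single_apply]

theorem monomial_expOf_Dmat {n p : ℕ} (a b : Fin n → Fin p) :
    (MvPolynomial.monomial (expOf p (Dmat a b)) 1 : MvPolynomial (Fin p × Fin p) ℂ) =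
      ∏ k, MvPolynomial.X (a k, b k) := by
  rw [expOf_Dmat, MvPolynomial.monomial_sum_one]
  rfl

theorem expOf_injective (p : ℕ) : Function.Injective (expOf p) := by
  intro D E h
  ext i j
  exact DFunLike.congr_fun h (i, j)

theorem sum_Dmat {n p : ℕ} (a b : Fin n → Fin p) : ∑ i, ∑ j, Dmat a b i j = n := by
  have h := congrArg (Finsupp.degree) (expOf_Dmat a b)
  rw [map_sum] at h
  simpa [Finsupp.degree_eq_sum, Fintype.sum_prod_type, expOf] using h

/-- `Σ_{a,b} e_a e_b ∏_k x_{a_k,b_k}`. -/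
def genPoly {n p : ℕ} (e : (Fin n → Fin p) → ℂ) : MvPolynomial (Fin p × Fin p) ℂ :=
  ∑ a, ∑ b, (e a * e b) • ∏ k, MvPolynomial.X (a k, b k)

theorem trace_eq_coeff_genPoly {n p : ℕ} (e : (Fin n → Fin p) → ℂ) (he : star e = e)
    (D : Matrix (Fin p) (Fin p) ℕ) :
    Matrix.trace ((Matrix.vecMulVec e e)ᴴ * AD n p D) =
      MvPolynomial.coeff (expOf p D) (genPoly e) := by
  rw [Matrix.conjTranspose_vecMulVec, he, genPoly, Matrix.trace, Finset.sum_comm,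
    MvPolynomial.coeff_sum]
  refine Finset.sum_congr rfl fun a _ => ?_
  rw [Matrix.diag_apply, Matrix.mul_apply, MvPolynomial.coeff_sum]
  refine Finset.sum_congr rfl fun b _ => ?_
  rw [← monomial_expOf_Dmat, MvPolynomial.coeff_smul, MvPolynomial.coeff_monomial]
  simp [AD, Matrix.vecMulVec_apply, (expOf_injective p).eq_iff, mul_comm]

theorem coeff_genPoly_eq_zero {n p : ℕ} (e : (Fin n → Fin p) → ℂ)
    (D : Matrix (Fin p) (Fin p) ℕ) (hD : ∑ i, ∑ j, D i j ≠ n) :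
    MvPolynomial.coeff (expOf p D) (genPoly e) = 0 := by
  rw [genPoly, MvPolynomial.coeff_sum]
  refine Finset.sum_eq_zero fun a _ => ?_
  rw [MvPolynomial.coeff_sum]
  refine Finset.sum_eq_zero fun b _ => ?_
  rw [← monomial_expOf_Dmat, MvPolynomial.coeff_smul, MvPolynomial.coeff_monomial, if_neg,
    smul_zero]
  intro h
  exact hD (expOf_injective p h ▸ sum_Dmat a b)

theorem genPoly_sum_smul_single {n p : ℕ} {ι : Type*} (s : Finset ι) (c : ι → ℂ)
    (w : ι → Fin n → Fin p) :
    genPoly (∑ i ∈ s, c i • (Pi.single (w i) (1 : ℂ) : (Fin n → Fin p) → ℂ)) =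
      ∑ i ∈ s, ∑ j ∈ s, (c i * c j) • ∏ k, MvPolynomial.X (w i k, w j k) := by
  have key : ∀ F : (Fin n → Fin p) → MvPolynomial (Fin p × Fin p) ℂ,
      ∑ a, (∑ i ∈ s, c i • (Pi.single (w i) (1 : ℂ) : (Fin n → Fin p) → ℂ)) a • F a =
        ∑ i ∈ s, c i • F (w i) := by
    intro F
    simp only [Finset.sum_apply, Pi.smul_apply, Finset.sum_smul]
    rw [Finset.sum_comm]
    refine Finset.sum_congr rfl fun i _ => ?_
    rw [Finset.sum_eq_single (w i)] <;> simp +contextual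
  simp only [genPoly, mul_smul, ← Finset.smul_sum, key]

theorem fPoly_vecMulVec {n p : ℕ} (e : (Fin n → Fin p) → ℂ) (he : star e = e) :
    fPoly n p (Matrix.vecMulVec e e) = genPoly e := by
  ext m
  obtain ⟨D, rfl⟩ : ∃ D, expOf p D = m :=
    ⟨Matrix.of fun i j => m (i, j), by ext; rfl⟩
  simp only [fPoly, MvPolynomial.coeff_sum, MvPolynomial.coeff_monomial,
    trace_eq_coeff_genPoly e he]
  by_cases hD : ∑ i, ∑ j, D i j = n
  · have hle : ∀ i j, D i j < n + 1 := fun i j => by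
      have h₁ := Finset.single_le_sum (f := fun j => D i j) (fun _ _ => Nat.zero_le _)
        (Finset.mem_univ j)
      have h₂ := Finset.single_le_sum (f := fun i => ∑ j, D i j) (fun _ _ => Nat.zero_le _)
        (Finset.mem_univ i)
      omega
    rw [Finset.sum_eq_single (fun i j => ⟨D i j, hle i j⟩)]
    · exact if_pos rfl
    · intro E _ hE
      refine if_neg fun h => hE ?_
      have := expOf_injective p h
      funext i j
      exact Fin.ext (congrFun (congrFun this i) j)
    · intro h
      exact absurd (by simpa using hD) h
  · rw [coeff_genPoly_eq_zero e D hD]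
    refine Finset.sum_eq_zero fun E hE => ?_
    split_ifs with h
    · have := expOf_injective p h
      subst this
      exact absurd (by simpa using hE) hD
    · rfl

/-! ### The vector `e_λ` -/

theorem eLam_eq {n p : ℕ} (hp : 0 < p) (lam : Fin p → ℕ) :
    eLam n p hp lam = ∑ σ ∈ colGroup n p lam, ((Equiv.Perm.sign σ : ℤ) : ℂ) •
      (Pi.single (fun k => tLam n p hp lam (σ⁻¹ k)) (1 : ℂ) : (Fin n → Fin p) → ℂ) := by
  have h : Finset.univ.filter (fun t' : Fin n → Fin p =>
      ∃ π ∈ rowGroup n p lam, t' = fun k => tLam n p hp lam (π⁻¹ k)) =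
      {tLam n p hp lam} := by
    ext t'
    simp only [Finset.mem_filter, Finset.mem_univ, true_and, Finset.mem_singleton]
    constructor
    · rintro ⟨π, hπ, rfl⟩
      funext k
      have := (Finset.mem_filter.mp hπ).2 (π⁻¹ k)
      rw [Equiv.Perm.coe_inv, Equiv.apply_symm_apply] at this
      simp [tLam, this]
    · rintro rfl
      exact ⟨1, by simp [rowGroup], by simp⟩
  simp only [eLam, eT, h, Finset.sum_singleton]

theorem star_eLam {n p : ℕ} (hp : 0 < p) (lam : Fin p → ℕ) :
    star (eLam n p hp lam) = eLam n p hp lam := by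
  rw [eLam_eq]
  funext a
  simp [Finset.sum_apply, Pi.single_apply, apply_ite]

theorem det_toSquareBlock_tLam {n p : ℕ} (hp : 0 < p) (lam : Fin p → ℕ)
    (hdec : ∀ i j : Fin p, i ≤ j → lam j ≤ lam i) (hsum : ∑ i, lam i = n) (c : Fin n) :
    ((Matrix.of fun k l : Fin n => (MvPolynomial.X (tLam n p hp lam k, tLam n p hp lam l) :
      MvPolynomial (Fin p × Fin p) ℂ)).toSquareBlock (boxCol lam) c).det =
    Matrix.det (Matrix.of fun i j : Fin (conjPart p lam (c + 1)) =>
      if h : (i : ℕ) < p ∧ (j : ℕ) < p then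
        (MvPolynomial.X (⟨i, h.1⟩, ⟨j, h.2⟩) : MvPolynomial (Fin p × Fin p) ℂ) else 0) := by
  rw [← Matrix.det_submatrix_equiv_self (colEquiv lam hdec hsum c)]
  congr 1
  ext1 k l
  have hk : rowOf p lam k.1 < p := rowOf_lt lam (hsum ▸ k.1.2)
  have hl : rowOf p lam l.1 < p := rowOf_lt lam (hsum ▸ l.1.2)
  simp [Matrix.toSquareBlock_def, colEquiv, tLam, hk, hl, Nat.mod_eq_of_lt]

theorem genPoly_eLam {n p : ℕ} (hp : 0 < p) (lam : Fin p → ℕ)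
    (hdec : ∀ i j : Fin p, i ≤ j → lam j ≤ lam i) (hsum : ∑ i, lam i = n) :
    genPoly (eLam n p hp lam) = Ppoly n p lam := by
  set t := tLam n p hp lam
  set N : Matrix (Fin n) (Fin n) (MvPolynomial (Fin p × Fin p) ℂ) :=
    Matrix.of fun k l => MvPolynomial.X (t k, t l) with hN
  have hinner : ∀ σ ∈ colGroup n p lam,
      ∑ τ ∈ colGroup n p lam,
        (((Equiv.Perm.sign σ : ℤ) : ℂ) * ((Equiv.Perm.sign τ : ℤ) : ℂ)) •
          ∏ k, (MvPolynomial.X (t (σ⁻¹ k), t (τ⁻¹ k)) : MvPolynomial (Fin p × Fin p) ℂ) =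
      ∏ c : Fin n, (N.toSquareBlock (boxCol lam) c).det := by
    intro σ hσ
    rw [← sum_sign_mul_prod_eq_prod_det _ _ _ (mem_colGroup_iff lam)]
    symm
    refine Finset.sum_bij (fun ρ _ => σ * ρ)
      (fun ρ hρ => (mul_mem_colGroup_iff hσ ρ).mpr hρ) (fun _ _ _ _ h => mul_left_cancel h)
      (fun τ hτ => ⟨σ⁻¹ * τ, (mul_mem_colGroup_iff hσ _).mp (by simpa using hτ), by simp⟩) ?_
    intro ρ _
    have hsign : ((Equiv.Perm.sign σ : ℤ) : ℂ) * ((Equiv.Perm.sign (σ * ρ) : ℤ) : ℂ) =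
        ((Equiv.Perm.sign ρ : ℤ) : ℂ) := by
      rw [← Int.cast_mul, Equiv.Perm.sign_mul, ← Units.val_mul, ← mul_assoc,
        Int.units_mul_self, one_mul]
    rw [hsign, MvPolynomial.smul_eq_C_mul, map_intCast,
      ← Equiv.prod_comp (σ * ρ) fun k => (MvPolynomial.X (t (σ⁻¹ k), t ((σ * ρ)⁻¹ k)) :
        MvPolynomial (Fin p × Fin p) ℂ)]
    simp [hN]
  rw [eLam_eq, genPoly_sum_smul_single, Finset.sum_congr rfl hinner, Finset.sum_const,
    card_colGroup lam hdec hsum, Ppoly,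
    ← Fin.prod_univ_eq_prod_range fun j => Qpoly p (conjPart p lam (j + 1))]
  simp only [Qpoly, Finset.prod_mul_distrib, nsmul_eq_mul, Nat.cast_prod]
  congr 1
  exact Finset.prod_congr rfl fun c _ => det_toSquareBlock_tLam hp lam hdec hsum c

/-- for every partition `λ` of `n` into at most `p` parts and every
`D ∈ P(n,p)`, the trace inner product `⟨A_D, e_λ e_λᵀ⟩` equals the coefficient of `x^D`
in `P_λ`; equivalently, `f_{e_λ e_λᵀ} = P_λ`. -/
theorem stmt_7 (n p : ℕ) (hn : 1 ≤ n) (hp : 0 < p) (lam : Fin p → ℕ)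
    (hdec : ∀ i j : Fin p, i ≤ j → lam j ≤ lam i) (hsum : ∑ i, lam i = n) :
    (∀ D : Matrix (Fin p) (Fin p) ℕ, (∑ i, ∑ j, D i j = n) →
      Matrix.trace ((Matrix.vecMulVec (eLam n p hp lam) (eLam n p hp lam))ᴴ * AD n p D) =
        MvPolynomial.coeff (expOf p D) (Ppoly n p lam)) ∧
    fPoly n p (Matrix.vecMulVec (eLam n p hp lam) (eLam n p hp lam)) = Ppoly n p lam := by
  rw [fPoly_vecMulVec _ (star_eLam hp lam), genPoly_eLam hp lam hdec hsum]
  refine ⟨fun D _ => ?_, rfl⟩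
  rw [trace_eq_coeff_genPoly _ (star_eLam hp lam), genPoly_eLam hp lam hdec hsum]
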